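/- Let L = {(0,0,x₃,x₄,x₅,x₆) : x₃,x₄,x₅,x₆ ∈ 𝔽₂} ⊆ 𝔽₂^6 and let π : 𝔽₂^6 → 𝔽₂^6 be the permutation π(x) = (x₁ + x₃x₄ + x₅x₆, x₂, x₃, x₄, x₅, x₆). Then f_{(π,L)} : 𝔽₂^6 × 𝔽₂^6 → 𝔽₂ is not a bent function. -/

import Mathlib

/-- Dot product on `𝔽₂^m`. -/
def dotp {m : ℕ} (x y : Fin m → ZMod 2) : ZMod 2 := ∑ i, x i * y i

/-- `f : 𝔽₂^m × 𝔽₂^m → 𝔽₂` is bent: every Walsh–Hadamard coefficient is `±2^m`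
(the dimension is `t = 2m`, so `2^{t/2} = 2^m`). -/
def IsBent2m {m : ℕ} (f : (Fin m → ZMod 2) × (Fin m → ZMod 2) → ZMod 2) : Prop :=
  ∀ a : (Fin m → ZMod 2) × (Fin m → ZMod 2),
    (∑ z : (Fin m → ZMod 2) × (Fin m → ZMod 2),
        (-1 : ℤ) ^ ((f z + dotp a.1 z.1 + dotp a.2 z.2).val)) = 2 ^ m ∨
    (∑ z : (Fin m → ZMod 2) × (Fin m → ZMod 2),
        (-1 : ℤ) ^ ((f z + dotp a.1 z.1 + dotp a.2 z.2).val)) = -2 ^ m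

/-- Carlet's function `f_{(π,L)}(x,y) = x·π(y) + 1_{L^⊥}(x)`. -/
noncomputable def fpl {m : ℕ} (π : (Fin m → ZMod 2) → (Fin m → ZMod 2))
    (L : Set (Fin m → ZMod 2)) (z : (Fin m → ZMod 2) × (Fin m → ZMod 2)) : ZMod 2 :=
  dotp z.1 (π z.2) +
    ({y : Fin m → ZMod 2 | ∀ x ∈ L, dotp x y = 0}).indicator (fun _ => 1) z.1

/-- The orthogonal complement of `{x | x 0 = 0 ∧ x 1 = 0}` is cut out by the other coordinates. -/
theorem forall_dotp_eq_zero_iff (y : Fin 6 → ZMod 2) :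
    (∀ x ∈ {x : Fin 6 → ZMod 2 | x 0 = 0 ∧ x 1 = 0}, dotp x y = 0) ↔
      y 2 = 0 ∧ y 3 = 0 ∧ y 4 = 0 ∧ y 5 = 0 := by
  constructor
  · intro h
    have single (i : Fin 6) (h0 : i ≠ 0) (h1 : i ≠ 1) : y i = 0 := by
      simpa [dotp, Pi.single_apply] using
        h (Pi.single i 1) ⟨Pi.single_eq_of_ne' h0 1, Pi.single_eq_of_ne' h1 1⟩
    exact ⟨single 2 (by decide) (by decide), single 3 (by decide) (by decide),
      single 4 (by decide) (by decide), single 5 (by decide) (by decide)⟩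
  · rintro ⟨h2, h3, h4, h5⟩ x ⟨h0, h1⟩
    simp [dotp, Fin.sum_univ_six, h0, h1, h2, h3, h4, h5]

theorem sum_pi_fin_succ {α M : Type*} [Fintype α] [AddCommMonoid M] {n : ℕ}
    (f : (Fin (n + 1) → α) → M) :
    ∑ v, f v = ∑ a, ∑ v : Fin n → α, f (Fin.cons a v) := by
  rw [← (Fin.consEquiv fun _ : Fin (n + 1) => α).sum_comp, Fintype.sum_prod_type]
  rfl

theorem sum_pi_fin_six {α M : Type*} [Fintype α] [AddCommMonoid M] (f : (Fin 6 → α) → M) :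
    ∑ v, f v = ∑ a, ∑ b, ∑ c, ∑ d, ∑ e, ∑ g, f ![a, b, c, d, e, g] := by
  simp only [sum_pi_fin_succ, Fintype.sum_unique]
  congr! 13

theorem walsh_coefficient_eq :
    (∑ z : (Fin 6 → ZMod 2) × (Fin 6 → ZMod 2),
      (-1 : ℤ) ^ (z.1 0 * (z.2 0 + z.2 2 * z.2 3 + z.2 4 * z.2 5) + z.1 1 * z.2 1 +
        z.1 2 * z.2 2 + z.1 3 * z.2 3 + z.1 4 * z.2 4 + z.1 5 * z.2 5 +
        (if z.1 2 = 0 ∧ z.1 3 = 0 ∧ z.1 4 = 0 ∧ z.1 5 = 0 then 1 else 0) + z.2 0).val) = 32 := by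
  rw [Fintype.sum_prod_type, Fintype.sum_congr _ _ fun x => sum_pi_fin_six _, sum_pi_fin_six]
  decide +kernel

/-- for `L = {(0,0,x₃,x₄,x₅,x₆)} ⊆ 𝔽₂⁶` and
`π(x) = (x₁ + x₃x₄ + x₅x₆, x₂, x₃, x₄, x₅, x₆)`, the function
`f_{(π,L)} : 𝔽₂⁶ × 𝔽₂⁶ → 𝔽₂` is not bent. (Coordinates are 0-indexed.) -/
theorem stmt_16 :
    ¬ IsBent2m (fpl
      (fun x : Fin 6 → ZMod 2 => Function.update x 0
        (x 0 + x 2 * x 3 + x 4 * x 5))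
      {x : Fin 6 → ZMod 2 | x 0 = 0 ∧ x 1 = 0}) := by
  intro h
  have hw := h (0, Pi.single 0 1)
  have hs := walsh_coefficient_eq
  rw [Finset.sum_congr rfl (g := fun z => (-1 : ℤ) ^ (fpl
      (fun x : Fin 6 → ZMod 2 => Function.update x 0 (x 0 + x 2 * x 3 + x 4 * x 5))
      {x : Fin 6 → ZMod 2 | x 0 = 0 ∧ x 1 = 0} z +
      dotp 0 z.1 + dotp (Pi.single 0 1) z.2).val)] at hs
  · rw [hs] at hw
    norm_num at hw
  · intro z _
    have hL : {y : Fin 6 → ZMod 2 | ∀ x ∈ {x : Fin 6 → ZMod 2 | x 0 = 0 ∧ x 1 = 0},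
        dotp x y = 0} = {y | y 2 = 0 ∧ y 3 = 0 ∧ y 4 = 0 ∧ y 5 = 0} :=
      Set.ext forall_dotp_eq_zero_iff
    rw [fpl, hL, Set.indicator_apply]
    simp [dotp, Fin.sum_univ_six, Function.update, Pi.single_apply]
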